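/- Let n, s, d be integers with 1 ≤ d ≤ n and 1 ≤ s ≤ n, let b = ⌈s/3⌉ − 1 and assume b ≥ 1, and let Δ = ⌈30·((s·ln 2)/d + ln n)⌉ and assume Δ < 2s/3. Let T = ∑_{j=⌈Δ/2⌉}^{Δ} C(b,j)·C(s−b, Δ−j). Then T^d · 2^s · n^d < C(s,Δ)^d. -/

import Mathlib

/-- If a `b`-set is at most a third of an `s`-set, it contains at most a `3⁻ⁱ` fraction of
its `i`-subsets. -/
lemma three_pow_mul_choose_le_choose {b s : ℕ} (h : 3 * b ≤ s) (i : ℕ) :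
    3 ^ i * b.choose i ≤ s.choose i := by
  induction i with
  | zero => simp
  | succ i ih =>
    refine Nat.le_of_mul_le_mul_right ?_ i.succ_pos
    calc 3 ^ (i + 1) * b.choose (i + 1) * (i + 1)
        = 3 ^ (i + 1) * (b.choose i * (b - i)) := by
          rw [mul_assoc, Nat.choose_succ_right_eq]
      _ = (3 ^ i * b.choose i) * (3 * (b - i)) := by ring
      _ ≤ s.choose i * (s - i) := Nat.mul_le_mul ih (by omega)
      _ = s.choose (i + 1) * (i + 1) := (Nat.choose_succ_right_eq s i).symm

/-- A Vandermonde identity with one factor absorbing a `choose`. -/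
lemma sum_choose_mul_choose_mul_choose (b c : ℕ) {i m : ℕ} (hi : i ≤ m) :
    ∑ j ∈ Finset.range (m + 1), b.choose j * j.choose i * c.choose (m - j) =
      b.choose i * (b - i + c).choose (m - i) := by
  obtain ⟨k, rfl⟩ := Nat.exists_eq_add_of_le hi
  rw [add_assoc, Finset.sum_range_add, Finset.sum_eq_zero, zero_add, Nat.add_sub_cancel_left,
    Nat.add_choose_eq, Finset.Nat.sum_antidiagonal_eq_sum_range_succ_mk, Finset.mul_sum]
  · refine Finset.sum_congr rfl fun j _ => ?_
    rw [Nat.choose_mul (Nat.le_add_right i j), Nat.add_sub_cancel_left, Nat.add_sub_add_left,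
      mul_assoc]
  · intro j hj
    rw [Nat.choose_eq_zero_of_lt (Finset.mem_range.1 hj)]
    simp

/-- The factorial moment expansion of `∑ j, C(b,j) 2ʲ C(c,m-j)`. -/
lemma sum_choose_mul_two_pow_mul_choose (b c m : ℕ) :
    ∑ j ∈ Finset.range (m + 1), b.choose j * 2 ^ j * c.choose (m - j) =
      ∑ i ∈ Finset.range (m + 1), b.choose i * (b - i + c).choose (m - i) := by
  calc ∑ j ∈ Finset.range (m + 1), b.choose j * 2 ^ j * c.choose (m - j)
      = ∑ j ∈ Finset.range (m + 1), ∑ i ∈ Finset.range (m + 1),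
          b.choose j * j.choose i * c.choose (m - j) := by
        refine Finset.sum_congr rfl fun j hj => ?_
        rw [← Finset.sum_mul, ← Finset.mul_sum, ← Nat.sum_range_choose j]
        congr 2
        refine Finset.sum_subset (Finset.range_mono (by simpa using hj)) fun i _ hi => ?_
        exact Nat.choose_eq_zero_of_lt (by simpa using hi)
    _ = _ := by
        rw [Finset.sum_comm]
        refine Finset.sum_congr rfl fun i hi => ?_
        exact sum_choose_mul_choose_mul_choose b c (Nat.lt_succ_iff.1 (Finset.mem_range.1 hi))

/-- The moment generating function of a hypergeometric variable with success density at most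
`1/3`, evaluated at `2`, is at most that of the binomial variable with density `1/3`. -/
lemma sum_choose_mul_two_pow_mul_choose_le {b s m : ℕ} (hbs : 3 * b ≤ s) (hm : m ≤ s) :
    ((∑ j ∈ Finset.range (m + 1), b.choose j * 2 ^ j * (s - b).choose (m - j) : ℕ) : ℝ) ≤
      s.choose m * (4 / 3) ^ m := by
  have hpow : ((4 : ℝ) / 3) ^ m = ∑ i ∈ Finset.range (m + 1), (1 / 3) ^ i * (m.choose i : ℝ) := by
    rw [show (4 : ℝ) / 3 = 1 / 3 + 1 by norm_num, add_pow]
    simp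
  rw [sum_choose_mul_two_pow_mul_choose, hpow, Nat.cast_sum, Finset.mul_sum]
  refine Finset.sum_le_sum fun i hi => ?_
  have him : i ≤ m := Nat.lt_succ_iff.1 (Finset.mem_range.1 hi)
  rcases lt_or_ge b i with hib | hib
  · rw [Nat.choose_eq_zero_of_lt hib, zero_mul, Nat.cast_zero]
    positivity
  have key : 3 ^ i * (b.choose i * (b - i + (s - b)).choose (m - i)) ≤
      s.choose m * m.choose i := by
    rw [Nat.choose_mul him, ← mul_assoc, show b - i + (s - b) = s - i by omega]
    exact Nat.mul_le_mul_right _ (three_pow_mul_choose_le_choose hbs i)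
  have key' : (3 : ℝ) ^ i * (b.choose i * (b - i + (s - b)).choose (m - i) : ℕ) ≤
      s.choose m * m.choose i := by exact_mod_cast key
  rw [one_div, inv_pow, mul_left_comm, inv_mul_eq_div, le_div_iff₀ (by positivity), mul_comm]
  exact key'

/-- Chernoff bound for the upper half tail of a hypergeometric variable with success density at
most `1/3`. -/
lemma hypergeometric_half_tail_mul_sqrt_two_pow_le {b s m : ℕ} (hbs : 3 * b ≤ s) (hm : m ≤ s) :
    ((∑ j ∈ Finset.Icc ⌈(m : ℝ) / 2⌉₊ m, b.choose j * (s - b).choose (m - j) : ℕ) : ℝ) *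
      √2 ^ m ≤ s.choose m * (4 / 3) ^ m := by
  refine le_trans ?_ (sum_choose_mul_two_pow_mul_choose_le hbs hm)
  rw [Nat.cast_sum, Nat.cast_sum, Finset.sum_mul]
  refine (Finset.sum_le_sum fun j hj => ?_).trans
    (Finset.sum_le_sum_of_subset_of_nonneg (fun j hj => ?_) fun _ _ _ => Nat.cast_nonneg _)
  · have hj' : (m : ℝ) / 2 ≤ j := Nat.ceil_le.1 (Finset.mem_Icc.1 hj).1
    have hmj : m ≤ 2 * j := by
      have : (m : ℝ) ≤ 2 * j := by linarith
      exact_mod_cast this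
    have hpow : √2 ^ m ≤ (2 : ℝ) ^ j := by
      calc √2 ^ m ≤ √2 ^ (2 * j) :=
            pow_le_pow_right₀ (Real.one_le_sqrt.2 one_le_two) hmj
        _ = 2 ^ j := by rw [pow_mul, Real.sq_sqrt zero_le_two]
    push_cast
    rw [mul_right_comm]
    gcongr
  · exact Finset.mem_range.2 (Nat.lt_succ_iff.2 (Finset.mem_Icc.1 hj).2)

lemma four_thirds_mul_exp_lt_sqrt_two : (4 / 3 : ℝ) * Real.exp (1 / 30) < √2 := by
  have h1 : Real.exp (1 / 30) ≤ 1 / (1 - 1 / 30) :=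
    Real.exp_bound_div_one_sub_of_interval (by norm_num) (by norm_num)
  have h2 : (7 / 5 : ℝ) < √2 := Real.lt_sqrt_of_sq_lt (by norm_num)
  norm_num at h1
  linarith

/-- Hypergeometric tail bound for the bit-publishing graph: with `1 ≤ d ≤ n`,
`1 ≤ s ≤ n`, `b = ⌈s/3⌉ − 1 ≥ 1`, `Δ = ⌈30((s ln 2)/d + ln n)⌉ < 2s/3`, and
`T = ∑_{j=⌈Δ/2⌉}^{Δ} C(b,j)·C(s−b, Δ−j)`, we have `T^d · 2^s · n^d < C(s,Δ)^d`. -/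
theorem hypergeometric_tail_bound_publish (n d s b Δ : ℕ) (hd : 1 ≤ d) (hdn : d ≤ n)
    (hs1 : 1 ≤ s) (hsn : s ≤ n) (hb : b = ⌈(s : ℝ) / 3⌉₊ - 1) (hb1 : 1 ≤ b)
    (hΔ : Δ = ⌈30 * (((s : ℝ) * Real.log 2) / (d : ℝ) + Real.log n)⌉₊)
    (hΔlt : (Δ : ℝ) < 2 * (s : ℝ) / 3)
    (T : ℕ)
    (hT : T = ∑ j ∈ Finset.Icc ⌈(Δ : ℝ) / 2⌉₊ Δ, b.choose j * (s - b).choose (Δ - j)) :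
    (T : ℝ) ^ d * 2 ^ s * (n : ℝ) ^ d < ((s.choose Δ : ℕ) : ℝ) ^ d := by
  have hd0 : (0 : ℝ) < d := by exact_mod_cast hd
  have hn0 : (0 : ℝ) < n := by exact_mod_cast hd.trans hdn
  have hs0 : (0 : ℝ) < s := by exact_mod_cast hs1
  have hbs : 3 * b ≤ s := by
    have h : (b : ℝ) < s / 3 := Nat.lt_ceil.1 (by omega)
    have h' : (3 * b : ℝ) ≤ s := by linarith
    exact_mod_cast h'
  have hΔs : Δ ≤ s := by
    have h : (Δ : ℝ) ≤ s := by linarith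
    exact_mod_cast h
  have hle : 30 * (((s : ℝ) * Real.log 2) / d + Real.log n) ≤ Δ := hΔ ▸ Nat.le_ceil _
  have hlog : 0 ≤ Real.log n := Real.log_natCast_nonneg n
  have hΔ0 : Δ ≠ 0 := by
    have h1 : 0 < (s : ℝ) * Real.log 2 / d :=
      div_pos (mul_pos hs0 (Real.log_pos one_lt_two)) hd0
    have h2 : (0 : ℝ) < Δ := by linarith
    exact_mod_cast h2.ne'
  have hchoose : (0 : ℝ) < s.choose Δ := by exact_mod_cast Nat.choose_pos hΔs
  have hexp : (2 : ℝ) ^ s * (n : ℝ) ^ d ≤ (Real.exp (1 / 30) ^ Δ) ^ d := by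
    calc (2 : ℝ) ^ s * (n : ℝ) ^ d = Real.exp (s * Real.log 2 + d * Real.log n) := by
          rw [Real.exp_add, Real.exp_nat_mul, Real.exp_nat_mul, Real.exp_log two_pos,
            Real.exp_log hn0]
      _ ≤ Real.exp (d * (Δ * (1 / 30))) := by
          refine Real.exp_le_exp.2 ?_
          calc (s : ℝ) * Real.log 2 + d * Real.log n
              = d * (s * Real.log 2 / d + Real.log n) := by field_simp
            _ ≤ d * (Δ * (1 / 30)) := by gcongr; linarith
      _ = _ := by rw [Real.exp_nat_mul, Real.exp_nat_mul]
  have htail := hypergeometric_half_tail_mul_sqrt_two_pow_le hbs hΔs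
  rw [← hT] at htail
  have hstep : (T : ℝ) * Real.exp (1 / 30) ^ Δ < s.choose Δ := by
    have hsqrt : (0 : ℝ) < √2 ^ Δ := by positivity
    refine lt_of_mul_lt_mul_right ?_ hsqrt.le
    calc (T : ℝ) * Real.exp (1 / 30) ^ Δ * √2 ^ Δ
        = T * √2 ^ Δ * Real.exp (1 / 30) ^ Δ := by ring
      _ ≤ s.choose Δ * (4 / 3) ^ Δ * Real.exp (1 / 30) ^ Δ := by gcongr
      _ = s.choose Δ * (4 / 3 * Real.exp (1 / 30)) ^ Δ := by rw [mul_pow, mul_assoc]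
      _ < s.choose Δ * √2 ^ Δ :=
          mul_lt_mul_of_pos_left
            (pow_lt_pow_left₀ four_thirds_mul_exp_lt_sqrt_two (by positivity) hΔ0) hchoose
  calc (T : ℝ) ^ d * 2 ^ s * (n : ℝ) ^ d = (T : ℝ) ^ d * (2 ^ s * (n : ℝ) ^ d) := mul_assoc _ _ _
    _ ≤ (T : ℝ) ^ d * (Real.exp (1 / 30) ^ Δ) ^ d := by gcongr
    _ = (T * Real.exp (1 / 30) ^ Δ) ^ d := (mul_pow _ _ _).symm
    _ < (s.choose Δ : ℝ) ^ d := pow_lt_pow_left₀ hstep (by positivity) (by omega)
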